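/- arXiv:1512.01612 — 2 statements merged into one kernel-verified Lean document; each statement's English description precedes it below -/
import Mathlib

section
/- Let n ≥ 1, Y ∈ ℤ^n and σ ∈ S_n. Then for every X ∈ ℤ^n and t ≥ 0, the function t ↦ Λ_Y(X;t;σ) is differentiable and satisfies the free evolution equation: d/dt Λ_Y(X;t;σ) = Σ_{k=1}^{n} ( b_{x_k−1} Λ_Y(X^{k,−};t;σ) − b_{x_k} Λ_Y(X;t;σ) ), where X^{k,−} is X with its k-th coordinate decreased by 1. -/
/-- Extended product `∏'_{k=m}^{n} f k`. -/
noncomputable def eprod (f : ℤ → ℂ) (m n : ℤ) : ℂ :=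
  if m ≤ n + 1 then ∏ k ∈ Finset.Icc m n, f k
  else ∏ k ∈ Finset.Icc (n + 1) (m - 1), (f k)⁻¹

/-- `A_σ(w_1,…,w_n)`: product of `S_{(β,α)}` over inversions `(β,α)` of `σ`. -/
noncomputable def Acoef (q : ℝ) {n : ℕ} (σ : Equiv.Perm (Fin n)) (w : Fin n → ℂ) : ℂ :=
  ∏ p ∈ Finset.univ.filter
      (fun p : Fin n × Fin n => p.2 < p.1 ∧ σ⁻¹ p.1 < σ⁻¹ p.2),
    (-((q : ℂ) * w p.1 - w p.2) / ((q : ℂ) * w p.2 - w p.1))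

/-- `B(w_1,…,w_n) = ∏_{i<j} (w_i - w_j)/(w_i - q w_j)`. -/
noncomputable def Bcoef (q : ℝ) {n : ℕ} (w : Fin n → ℂ) : ℂ :=
  ∏ p ∈ Finset.univ.filter (fun p : Fin n × Fin n => p.1 < p.2),
    (w p.1 - w p.2) / (w p.1 - (q : ℂ) * w p.2)

/-- Iterated contour integral over `n` counterclockwise circles of radius `R` centred at `0`,
outermost variable first. -/
noncomputable def mcInt : (n : ℕ) → ℝ → ((Fin n → ℂ) → ℂ) → ℂ
  | 0, _, f => f (fun i => i.elim0)
  | n + 1, R, f => ∮ z in C(0, R), mcInt n R (fun w => f (Fin.cons z w))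

/-- `Λ_Y(X;t;σ)`, with all contours the counterclockwise circle of radius `R`. -/
noncomputable def Lam (q : ℝ) (b : ℤ → ℝ) {n : ℕ} (Y X : Fin n → ℤ)
    (t : ℝ) (σ : Equiv.Perm (Fin n)) (R : ℝ) : ℂ :=
  (∏ k, (-1 : ℂ) / (b (X k) : ℂ)) * (1 / (2 * Real.pi * Complex.I)) ^ n *
    mcInt n R (fun w =>
      Acoef q σ w *
        ∏ j, (eprod (fun k => (b k : ℂ) / ((b k : ℂ) - w (σ j))) (Y (σ j)) (X j) *
          Complex.exp (-(w j) * (t : ℂ))))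

/-- `R` is a valid contour radius for `Λ_Y(X;·;·)`: `R > b k` for every integer `k` in
`[min_j min(x_j, y_j) - 1, max_j max(x_j, y_j)]`. -/
def ValidR (b : ℤ → ℝ) {n : ℕ} (X Y : Fin n → ℤ) (R : ℝ) : Prop :=
  ∀ k : ℤ, (∃ j, min (X j) (Y j) - 1 ≤ k) → (∃ j, k ≤ max (X j) (Y j)) → b k < R

/-- Number of coordinates of `X` equal to `s`. -/
def cnt {n : ℕ} (X : Fin n → ℤ) (s : ℤ) : ℕ :=
  (Finset.univ.filter (fun j => X j = s)).card

/-- The `q`-deformed factorial `[k]_q! = ∏_{j=1}^{k} (1-q^j)/(1-q)`. -/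
noncomputable def qfac (q : ℝ) (k : ℕ) : ℝ :=
  ∏ j ∈ Finset.Icc 1 k, (1 - q ^ j) / (1 - q)

/-- `W(X) = ∏_i [k_i]_q!` over the distinct values of `X` with multiplicities `k_i`. -/
noncomputable def Wcoef (q : ℝ) {n : ℕ} (X : Fin n → ℤ) : ℝ :=
  ∏ s ∈ Finset.univ.image X, qfac q (cnt X s)

/-- For `X` weakly decreasing, `lowerLast X s = X^{K,-}` where the coordinate lowered by `1`
is the last one equal to `s`. -/
def lowerLast {n : ℕ} (X : Fin n → ℤ) (s : ℤ) : Fin n → ℤ :=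
  fun j => if X j = s ∧ ∀ i, j < i → X i ≠ s then X j - 1 else X j

/-- The `q`-TAZRP master equation for a family `P(X;·)`, `X ∈ 𝕎^n`. -/
def MasterEq (q : ℝ) (a : ℤ → ℝ) {n : ℕ} (P : (Fin n → ℤ) → ℝ → ℂ) : Prop :=
  ∀ X : Fin n → ℤ, Antitone X → ∀ t : ℝ, 0 ≤ t →
    HasDerivAt (P X)
      ((∑ s ∈ Finset.univ.image X,
          (1 - (q : ℂ) ^ cnt (lowerLast X s) (s - 1)) * (a (s - 1) : ℂ) * P (lowerLast X s) t) -
        ∑ s ∈ Finset.univ.image X,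
          (1 - (q : ℂ) ^ cnt X s) * (a s : ℂ) * P X t) t

/-- The tuple `X` with coordinates `k` and `k+1` (0-based) replaced by `u` and `v`. -/
def set2 {n : ℕ} (X : Fin n → ℤ) (k : ℕ) (h : k + 1 < n) (u v : ℤ) : Fin n → ℤ :=
  Function.update (Function.update X ⟨k, by omega⟩ u) ⟨k + 1, h⟩ v

/-- The free particle evolution equation. -/
def FreeEvol (b : ℤ → ℝ) {n : ℕ} (u : (Fin n → ℤ) → ℝ → ℂ) : Prop :=
  ∀ X : Fin n → ℤ, ∀ t : ℝ, 0 ≤ t →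
    HasDerivAt (u X)
      (∑ k, ((b (X k - 1) : ℂ) * u (Function.update X k (X k - 1)) t -
        (b (X k) : ℂ) * u X t)) t

/-- The boundary conditions. -/
def BoundaryCond (q : ℝ) (b : ℤ → ℝ) {n : ℕ} (u : (Fin n → ℤ) → ℝ → ℂ) : Prop :=
  ∀ (k : ℕ) (h : k + 1 < n) (X : Fin n → ℤ) (x : ℤ) (t : ℝ), 0 ≤ t →
    (b (x - 1) : ℂ) * u (set2 X k h (x - 1) x) t =
      (q : ℂ) * (b (x - 1) : ℂ) * u (set2 X k h x (x - 1)) t +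
        (1 - (q : ℂ)) * (b x : ℂ) * u (set2 X k h x x) t

/-- The explicit one-particle transition probability. -/
noncomputable def P1 (b : ℤ → ℝ) (y x : ℤ) (t : ℝ) : ℝ :=
  if x < y then 0
  else if x = y then Real.exp (-(b y) * t)
  else (∏ k ∈ Finset.Icc y (x - 1), b k) *
    ∑ k ∈ Finset.Icc y x,
      (∏ j ∈ (Finset.Icc y x).erase k, (b j - b k)⁻¹) * Real.exp (-(b k) * t)

/-- The torus of radius `R` centred at `0`, on which `mcInt` integrates. -/
def torusSet (n : ℕ) (R : ℝ) : Set (Fin n → ℂ) :=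
  {w | ∀ i, ‖w i‖ = R}

theorem torusMap_mem_torusSet {n : ℕ} {R : ℝ} (hR : 0 ≤ R) (θ : Fin n → ℝ) :
    torusMap 0 (fun _ => R) θ ∈ torusSet n R := by
  intro i
  simp [torusMap, Complex.norm_exp, abs_of_nonneg hR]

theorem continuous_torusMap {n : ℕ} (c : Fin n → ℂ) (R : Fin n → ℝ) :
    Continuous (torusMap c R) := by
  unfold torusMap
  fun_prop

theorem isCompact_torusSet (n : ℕ) (R : ℝ) : IsCompact (torusSet n R) := by
  have h : torusSet n R = Set.pi Set.univ (fun _ => Metric.sphere (0 : ℂ) R) := by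
    ext w
    simp [torusSet]
  rw [h]
  exact isCompact_univ_pi fun _ => isCompact_sphere 0 R

theorem cons_mem_torusSet {n : ℕ} {R : ℝ} {z : ℂ} {w : Fin n → ℂ} (hz : ‖z‖ = R)
    (hw : w ∈ torusSet n R) : (Fin.cons z w : Fin (n + 1) → ℂ) ∈ torusSet (n + 1) R := by
  intro i
  refine Fin.cases ?_ (fun j => ?_) i
  · simpa using hz
  · simpa using hw j

theorem ContinuousOn.comp_torusMap {n : ℕ} {R : ℝ} (hR : 0 ≤ R) {f : (Fin n → ℂ) → ℂ}
    (hf : ContinuousOn f (torusSet n R)) :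
    Continuous fun θ => f (torusMap 0 (fun _ => R) θ) :=
  hf.comp_continuous (continuous_torusMap _ _) (torusMap_mem_torusSet hR)

theorem ContinuousOn.torusIntegrable {n : ℕ} {R : ℝ} (hR : 0 ≤ R) {f : (Fin n → ℂ) → ℂ}
    (hf : ContinuousOn f (torusSet n R)) : TorusIntegrable f 0 (fun _ => R) :=
  (hf.comp_torusMap hR).continuousOn.integrableOn_compact isCompact_Icc

theorem mcInt_congr {R : ℝ} (hR : 0 ≤ R) {n : ℕ} {f g : (Fin n → ℂ) → ℂ}
    (h : Set.EqOn f g (torusSet n R)) : mcInt n R f = mcInt n R g := by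
  induction n with
  | zero => exact h fun i => i.elim0
  | succ n ih =>
    refine circleIntegral.integral_congr hR fun z hz => ih fun w hw => h ?_
    exact cons_mem_torusSet (by simpa using hz) hw

theorem mcInt_eq_torusIntegral {R : ℝ} (hR : 0 ≤ R) {n : ℕ} {f : (Fin n → ℂ) → ℂ}
    (hf : ContinuousOn f (torusSet n R)) :
    mcInt n R f = torusIntegral f 0 (fun _ => R) := by
  induction n with
  | zero =>
    rw [torusIntegral_dim0]
    exact congrArg f (Subsingleton.elim _ _)
  | succ n ih =>
    rw [torusIntegral_succ (hf.torusIntegrable hR)]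
    refine circleIntegral.integral_congr hR fun z hz => ih ?_
    refine hf.comp (by fun_prop) fun w hw => ?_
    exact cons_mem_torusSet (by simpa using hz) hw

theorem mcInt_sum_mul {R : ℝ} (hR : 0 ≤ R) {n : ℕ} {ι : Type*} (s : Finset ι) (c : ι → ℂ)
    {f : ι → (Fin n → ℂ) → ℂ} (hf : ∀ i, ContinuousOn (f i) (torusSet n R)) :
    mcInt n R (fun w => ∑ i ∈ s, c i * f i w) = ∑ i ∈ s, c i * mcInt n R (f i) := by
  have hint : ∀ i, mcInt n R (f i) = torusIntegral (f i) 0 (fun _ => R) :=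
    fun i => mcInt_eq_torusIntegral hR (hf i)
  rw [mcInt_eq_torusIntegral (f := fun w => ∑ i ∈ s, c i * f i w) hR
    (continuousOn_finsetSum s fun i _ => continuousOn_const.mul (hf i))]
  simp only [hint, ← torusIntegral_const_mul]
  simp only [torusIntegral, Finset.smul_sum]
  exact MeasureTheory.integral_finsetSum s fun i _ =>
    (ContinuousOn.torusIntegrable hR (continuousOn_const.mul (hf i))).function_integrable

/-- Differentiation under the contour integrals. -/
theorem hasDerivAt_mcInt_mul_exp {R : ℝ} (hR : 0 ≤ R) {n : ℕ} {g p : (Fin n → ℂ) → ℂ}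
    (hg : ContinuousOn g (torusSet n R)) (hp : ContinuousOn p (torusSet n R)) (t : ℝ) :
    HasDerivAt (fun s : ℝ => mcInt n R fun w => g w * Complex.exp (p w * s))
      (mcInt n R fun w => p w * (g w * Complex.exp (p w * t))) t := by
  have hF : ∀ s : ℝ, ContinuousOn (fun w => g w * Complex.exp (p w * s)) (torusSet n R) :=
    fun s => hg.mul (hp.mul continuousOn_const).cexp
  have hF' : ContinuousOn (fun w => p w * (g w * Complex.exp (p w * t))) (torusSet n R) :=
    hp.mul (hF t)
  have hFeq : (fun s : ℝ => mcInt n R fun w => g w * Complex.exp (p w * s)) =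
      fun s : ℝ => torusIntegral (fun w => g w * Complex.exp (p w * s)) 0 (fun _ => R) :=
    funext fun s => mcInt_eq_torusIntegral hR (hF s)
  rw [hFeq, mcInt_eq_torusIntegral hR hF']
  obtain ⟨A, hA⟩ := (isCompact_torusSet n R).exists_bound_of_continuousOn hg
  obtain ⟨B, hB⟩ := (isCompact_torusSet n R).exists_bound_of_continuousOn hp
  have hmem := torusMap_mem_torusSet (n := n) hR
  refine (hasDerivAt_integral_of_dominated_loc_of_deriv_le (s := Metric.ball t 1)
    (F' := fun (s : ℝ) θ => (∏ i : Fin n, (R : ℂ) * Complex.exp (θ i * Complex.I) * Complex.I) •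
      (p (torusMap 0 (fun _ => R) θ) * (g (torusMap 0 (fun _ => R) θ) *
        Complex.exp (p (torusMap 0 (fun _ => R) θ) * s))))
    (bound := fun _ => R ^ n * (B * (A * Real.exp (B * (|t| + 1)))))
    (Metric.ball_mem_nhds t one_pos)
    (Filter.Eventually.of_forall fun s =>
      ((hF s).torusIntegrable hR).function_integrable.aestronglyMeasurable)
    ((hF t).torusIntegrable hR).function_integrable
    (hF'.torusIntegrable hR).function_integrable.aestronglyMeasurable
    (Filter.Eventually.of_forall fun θ s hs => ?_)
    (MeasureTheory.integrableOn_const isCompact_Icc.measure_lt_top.ne)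
    (Filter.Eventually.of_forall fun θ s _ => ?_)).2
  · have hprod : ‖∏ i : Fin n, (R : ℂ) * Complex.exp (θ i * Complex.I) * Complex.I‖ = R ^ n := by
      simp [Complex.norm_exp, abs_of_nonneg hR]
    have hpB := hB _ (hmem θ)
    have hgA := hA _ (hmem θ)
    have hs' : |s| ≤ |t| + 1 := by
      have h1 : |s - t| < 1 := by simpa [Real.dist_eq] using hs
      have h2 := abs_sub_abs_le_abs_sub s t
      linarith
    have hB0 : 0 ≤ B := (norm_nonneg _).trans hpB
    have hA0 : 0 ≤ A := (norm_nonneg _).trans hgA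
    have hexp : ‖Complex.exp (p (torusMap 0 (fun _ => R) θ) * s)‖ ≤
        Real.exp (B * (|t| + 1)) := by
      refine (Complex.norm_exp_le_exp_norm _).trans (Real.exp_le_exp.2 ?_)
      rw [norm_mul, Complex.norm_real, Real.norm_eq_abs]
      gcongr
    rw [norm_smul, norm_mul, norm_mul, hprod]
    gcongr
  · have h1 : HasDerivAt (fun s : ℝ => p (torusMap 0 (fun _ => R) θ) * (s : ℂ))
        (p (torusMap 0 (fun _ => R) θ)) s := by
      simpa using (Complex.ofRealCLM.hasDerivAt (x := s)).const_mul
        (p (torusMap 0 (fun _ => R) θ))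
    refine ((h1.cexp.const_mul (g (torusMap 0 (fun _ => R) θ))).const_smul
      (∏ i : Fin n, (R : ℂ) * Complex.exp (θ i * Complex.I) * Complex.I)).congr_deriv ?_
    simp only [smul_eq_mul]
    ring

theorem eprod_mul_eq {f : ℤ → ℂ} (m n : ℤ) (h : f n ≠ 0) :
    eprod f m (n - 1) * f n = eprod f m n := by
  unfold eprod
  rcases lt_trichotomy m (n + 1) with hlt | rfl | hgt
  · rw [if_pos (by omega), if_pos (by omega)]
    have hins : Finset.Icc m n = insert n (Finset.Icc m (n - 1)) := by
      ext k
      simp only [Finset.mem_insert, Finset.mem_Icc]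
      omega
    rw [hins, Finset.prod_insert (by simp), mul_comm]
  · rw [if_neg (by omega), if_pos le_rfl]
    simp [h]
  · rw [if_neg (by omega), if_neg (by omega)]
    have hins : Finset.Icc (n - 1 + 1) (m - 1) = insert n (Finset.Icc (n + 1) (m - 1)) := by
      ext k
      simp only [Finset.mem_insert, Finset.mem_Icc]
      omega
    rw [hins, Finset.prod_insert (by simp)]
    field_simp

theorem continuousOn_eprod {α : Type*} [TopologicalSpace α] {S : Set α} {f : α → ℤ → ℂ} {m n : ℤ}
    (hf : ∀ k ∈ Set.uIcc m n, ContinuousOn (fun w => f w k) S)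
    (hne : ∀ k ∈ Set.uIcc m n, ∀ w ∈ S, f w k ≠ 0) :
    ContinuousOn (fun w => eprod (f w) m n) S := by
  unfold eprod
  split_ifs with h
  · refine continuousOn_finsetProd _ fun k hk => hf k ?_
    rw [Finset.mem_Icc] at hk
    exact Set.mem_uIcc.2 (Or.inl hk)
  · have hmem : ∀ k ∈ Finset.Icc (n + 1) (m - 1), k ∈ Set.uIcc m n := fun k hk => by
      rw [Finset.mem_Icc] at hk
      exact Set.mem_uIcc.2 (Or.inr ⟨by omega, by omega⟩)
    exact continuousOn_finsetProd _ fun k hk =>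
      (hf k (hmem k hk)).inv₀ fun w hw => hne k (hmem k hk) w hw

theorem continuousOn_Acoef {q : ℝ} (hq : q ∈ Set.Ioo (0 : ℝ) 1) {n : ℕ}
    (σ : Equiv.Perm (Fin n)) {R : ℝ} (hR : 0 < R) :
    ContinuousOn (Acoef q σ) (torusSet n R) := by
  unfold Acoef
  refine continuousOn_finsetProd _ fun p _ => ContinuousOn.div (by fun_prop) (by fun_prop) ?_
  intro w hw h0
  have h := congrArg norm (sub_eq_zero.1 h0)
  rw [norm_mul, hw, hw, Complex.norm_real, Real.norm_of_nonneg hq.1.le] at h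
  nlinarith [hq.2]

theorem prod_apply_update {ι α M : Type*} [Fintype ι] [DecidableEq ι] [CommMonoid M]
    (φ : ι → α → M) (X : ι → α) (k : ι) (v : α) :
    ∏ j, φ j (Function.update X k v j) = φ k v * ∏ j ∈ Finset.univ.erase k, φ j (X j) := by
  rw [← Finset.mul_prod_erase _ _ (Finset.mem_univ k), Function.update_self]
  congr 1
  exact Finset.prod_congr rfl fun j hj => by
    rw [Function.update_of_ne (Finset.ne_of_mem_erase hj)]

/-- The time-independent factor of the integrand of `Lam`. -/
noncomputable def lamWeight (q : ℝ) (b : ℤ → ℝ) {n : ℕ} (Y X : Fin n → ℤ)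
    (σ : Equiv.Perm (Fin n)) (w : Fin n → ℂ) : ℂ :=
  Acoef q σ w * ∏ j, eprod (fun k => (b k : ℂ) / ((b k : ℂ) - w (σ j))) (Y (σ j)) (X j)

theorem Lam_eq (q : ℝ) (b : ℤ → ℝ) {n : ℕ} (Y X : Fin n → ℤ) (t : ℝ)
    (σ : Equiv.Perm (Fin n)) (R : ℝ) :
    Lam q b Y X t σ R =
      (∏ k, (-1 : ℂ) / (b (X k) : ℂ)) * (1 / (2 * Real.pi * Complex.I)) ^ n *
        mcInt n R (fun w => lamWeight q b Y X σ w * Complex.exp ((∑ j, -w (σ j)) * (t : ℂ))) := by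
  unfold Lam
  congr 2
  funext w
  rw [Finset.prod_mul_distrib, ← Complex.exp_sum, ← Finset.sum_mul,
    Equiv.sum_comp σ fun j => -w j, lamWeight, mul_assoc]

theorem ofReal_sub_ne_zero_of_lt {x R : ℝ} (hx : 0 < x) (hxR : x < R) {z : ℂ} (hz : ‖z‖ = R) :
    (x : ℂ) - z ≠ 0 := by
  intro h
  rw [← sub_eq_zero.1 h, Complex.norm_real, Real.norm_of_nonneg hx.le] at hz
  exact hxR.ne hz

theorem continuousOn_lamWeight {q : ℝ} (hq : q ∈ Set.Ioo (0 : ℝ) 1) {b : ℤ → ℝ}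
    (hb : ∀ i, 0 < b i) {n : ℕ} {Y X : Fin n → ℤ} (σ : Equiv.Perm (Fin n)) {R : ℝ}
    (hR0 : 0 < R) (hR : ValidR b X Y R) :
    ContinuousOn (lamWeight q b Y X σ) (torusSet n R) := by
  have hne : ∀ j, ∀ k ∈ Set.uIcc (Y (σ j)) (X j), ∀ w ∈ torusSet n R,
      (b k : ℂ) - w (σ j) ≠ 0 := by
    intro j k hk w hw
    refine ofReal_sub_ne_zero_of_lt (hb k) (hR k ?_ ?_) (hw _)
    · rcases Set.mem_uIcc.1 hk with h | h
      · exact ⟨σ j, by omega⟩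
      · exact ⟨j, by omega⟩
    · rcases Set.mem_uIcc.1 hk with h | h
      · exact ⟨j, by omega⟩
      · exact ⟨σ j, by omega⟩
  refine (continuousOn_Acoef hq σ hR0).mul (continuousOn_finsetProd _ fun j _ =>
    continuousOn_eprod (fun k hk => ?_) fun k hk w hw => ?_)
  · exact continuousOn_const.div (by fun_prop) (hne j k hk)
  · exact div_ne_zero (Complex.ofReal_ne_zero.2 (hb k).ne') (hne j k hk w hw)

theorem lamWeight_update {q : ℝ} {b : ℤ → ℝ} {n : ℕ} {Y X : Fin n → ℤ}
    {σ : Equiv.Perm (Fin n)} {k : Fin n} {w : Fin n → ℂ} (hb : (b (X k) : ℂ) ≠ 0)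
    (hw : (b (X k) : ℂ) - w (σ k) ≠ 0) :
    (b (X k) : ℂ) * lamWeight q b Y (Function.update X k (X k - 1)) σ w =
      ((b (X k) : ℂ) - w (σ k)) * lamWeight q b Y X σ w := by
  unfold lamWeight
  rw [prod_apply_update (fun j x =>
      eprod (fun k => (b k : ℂ) / ((b k : ℂ) - w (σ j))) (Y (σ j)) x),
    ← Finset.mul_prod_erase _ _ (Finset.mem_univ k),
    ← eprod_mul_eq (Y (σ k)) (X k) (div_ne_zero hb hw)]
  field_simp

theorem lam_update_sub {q : ℝ} (hq : q ∈ Set.Ioo (0 : ℝ) 1) {b : ℤ → ℝ}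
    (hb : ∀ i, 0 < b i) {n : ℕ} {Y X : Fin n → ℤ} (σ : Equiv.Perm (Fin n)) {R : ℝ}
    (hR0 : 0 < R) (hR : ValidR b X Y R) (t : ℝ) (k : Fin n) :
    (b (X k - 1) : ℂ) * Lam q b Y (Function.update X k (X k - 1)) t σ R -
        (b (X k) : ℂ) * Lam q b Y X t σ R =
      (∏ k, (-1 : ℂ) / (b (X k) : ℂ)) * (1 / (2 * Real.pi * Complex.I)) ^ n *
        mcInt n R (fun w => -w (σ k) *
          (lamWeight q b Y X σ w * Complex.exp ((∑ j, -w (σ j)) * (t : ℂ)))) := by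
  have hbk : ∀ i, (b i : ℂ) ≠ 0 := fun i => Complex.ofReal_ne_zero.2 (hb i).ne'
  have hG : ContinuousOn
      (fun w => lamWeight q b Y X σ w * Complex.exp ((∑ j, -w (σ j)) * (t : ℂ)))
      (torusSet n R) :=
    (continuousOn_lamWeight hq hb σ hR0 hR).mul (by fun_prop)
  have hupd : mcInt n R (fun w => lamWeight q b Y (Function.update X k (X k - 1)) σ w *
        Complex.exp ((∑ j, -w (σ j)) * (t : ℂ))) =
      mcInt n R (fun w => lamWeight q b Y X σ w * Complex.exp ((∑ j, -w (σ j)) * (t : ℂ))) +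
        (b (X k) : ℂ)⁻¹ * mcInt n R (fun w => -w (σ k) *
          (lamWeight q b Y X σ w * Complex.exp ((∑ j, -w (σ j)) * (t : ℂ)))) := by
    have hlin := mcInt_sum_mul hR0.le (n := n) Finset.univ ![1, (b (X k) : ℂ)⁻¹]
      (f := ![fun w => lamWeight q b Y X σ w * Complex.exp ((∑ j, -w (σ j)) * (t : ℂ)),
        fun w => -w (σ k) *
          (lamWeight q b Y X σ w * Complex.exp ((∑ j, -w (σ j)) * (t : ℂ)))])
      (Fin.forall_fin_two.2 ⟨hG, ContinuousOn.mul (by fun_prop) hG⟩)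
    simp only [Fin.sum_univ_two, Matrix.cons_val_zero, Matrix.cons_val_one, one_mul] at hlin
    rw [← hlin]
    refine mcInt_congr hR0.le fun w hw => ?_
    have hrec := lamWeight_update (q := q) (Y := Y) (σ := σ) (hbk (X k))
      (ofReal_sub_ne_zero_of_lt (hb (X k)) (hR (X k) ⟨k, by omega⟩ ⟨k, by omega⟩) (hw (σ k)))
    apply mul_left_cancel₀ (hbk (X k))
    rw [← mul_assoc, hrec]
    have := hbk (X k)
    field_simp
    ring
  rw [Lam_eq, Lam_eq, hupd, prod_apply_update (fun _ x => (-1 : ℂ) / (b x : ℂ)),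
    ← Finset.mul_prod_erase _ (fun j => (-1 : ℂ) / (b (X j) : ℂ)) (Finset.mem_univ k)]
  generalize mcInt n R _ = I₀, mcInt n R _ = I₁
  have h1 := hbk (X k)
  have h2 := hbk (X k - 1)
  field_simp
  ring

/-- each `Λ_Y(X;t;σ)` satisfies the free particle evolution equation. -/
theorem lam_free_evolution
    (q : ℝ) (hq : q ∈ Set.Ioo (0 : ℝ) 1) (a b : ℤ → ℝ)
    (ha : ∀ i, 0 < a i) (hb : ∀ i, b i = a i * (1 - q))
    (n : ℕ) (Y X : Fin (n + 1) → ℤ) (σ : Equiv.Perm (Fin (n + 1)))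
    (R : ℝ) (hR : ValidR b X Y R) (t : ℝ) (ht : 0 ≤ t) :
    HasDerivAt (fun s => Lam q b Y X s σ R)
      (∑ k, ((b (X k - 1) : ℂ) * Lam q b Y (Function.update X k (X k - 1)) t σ R -
        (b (X k) : ℂ) * Lam q b Y X t σ R)) t := by
  have hbpos : ∀ i, 0 < b i := fun i => by
    rw [hb]
    exact mul_pos (ha i) (sub_pos.2 hq.2)
  have hR0 : 0 < R := (hbpos (X 0)).trans (hR (X 0) ⟨0, by omega⟩ ⟨0, by omega⟩)
  have hW := continuousOn_lamWeight hq hbpos σ hR0 hR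
  have hG : ContinuousOn
      (fun w => lamWeight q b Y X σ w * Complex.exp ((∑ j, -w (σ j)) * (t : ℂ)))
      (torusSet (n + 1) R) := hW.mul (by fun_prop)
  rw [Finset.sum_congr rfl fun k _ => lam_update_sub hq hbpos σ hR0 hR t k, ← Finset.mul_sum]
  simp only [Lam_eq q b Y X _ σ R]
  refine ((hasDerivAt_mcInt_mul_exp hR0.le hW (by fun_prop) t).const_mul _).congr_deriv ?_
  congr 1
  have hlin := mcInt_sum_mul hR0.le Finset.univ (fun _ => (1 : ℂ))
    (f := fun k w => -w (σ k) *
      (lamWeight q b Y X σ w * Complex.exp ((∑ j, -w (σ j)) * (t : ℂ))))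
    fun k => ContinuousOn.mul (by fun_prop) hG
  simp only [one_mul, ← Finset.sum_mul] at hlin
  exact hlin
end

section
/- Let n ≥ 2, k ∈ {1,…,n}, and let σ ∈ S_n with σ(k) = 1; let λ = ψ_k(σ) ∈ S_{n−1}. Then for all complex w_1,…,w_n such that all denominators involved are nonzero: A_σ(w_1,…,w_n) = ( ∏_{j=1}^{k−1} (q w_{σ(j)} − w_1)/(w_{σ(j)} − q w_1) ) · A_λ(w_2,…,w_n), where A_λ is evaluated at (w_2,…,w_n) (the i-th argument of A_λ is w_{i+1}). -/
theorem Acoef_eq_prod_prod (q : ℝ) {n : ℕ} (σ : Equiv.Perm (Fin n)) (w : Fin n → ℂ) :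
    Acoef q σ w = ∏ b, ∏ a, if a < b ∧ σ⁻¹ b < σ⁻¹ a then
      (-((q : ℂ) * w b - w a) / ((q : ℂ) * w a - w b)) else 1 := by
  rw [Acoef, Finset.prod_filter, Fintype.prod_prod_type]

/-- Splitting off the inversions of `σ` that involve `0`. -/
theorem Acoef_succ (q : ℝ) {n : ℕ} (σ : Equiv.Perm (Fin (n + 1))) (lam : Equiv.Perm (Fin n))
    (h : ∀ i j, lam⁻¹ i < lam⁻¹ j ↔ σ⁻¹ i.succ < σ⁻¹ j.succ) (w : Fin (n + 1) → ℂ) :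
    Acoef q σ w = (∏ i : Fin n, if σ⁻¹ i.succ < σ⁻¹ 0 then
      (((q : ℂ) * w i.succ - w 0) / (w i.succ - (q : ℂ) * w 0)) else 1) *
      Acoef q lam (w ∘ Fin.succ) := by
  have hS (b a : ℂ) : -((q : ℂ) * b - a) / ((q : ℂ) * a - b) = (q * b - a) / (b - q * a) := by
    rw [← neg_sub b, div_neg, neg_div, neg_neg]
  simp only [Acoef_eq_prod_prod, hS, Fin.prod_univ_succ (n := n), Fin.not_lt_zero, false_and,
    if_false, Finset.prod_const_one, one_mul, Fin.succ_pos, true_and, Finset.prod_mul_distrib,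
    Fin.succ_lt_succ_iff, h, Function.comp_apply]

/-- factorization of `A_σ` for `σ(k) = 1`, with `λ = ψ_k(σ)`. -/
theorem A_sigma_factorization_psi
    (q : ℝ) (hq : q ∈ Set.Ioo (0 : ℝ) 1) (n : ℕ) (k : Fin (n + 2))
    (σ : Equiv.Perm (Fin (n + 2))) (hσ : σ k = 0)
    (lam : Equiv.Perm (Fin (n + 1)))
    (hlam : ∀ i : Fin (n + 1), (lam⁻¹ i : ℕ) =
      if (σ⁻¹ i.succ : ℕ) < (k : ℕ) then (σ⁻¹ i.succ : ℕ) else (σ⁻¹ i.succ : ℕ) - 1)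
    (w : Fin (n + 2) → ℂ)
    (hden : ∀ i j : Fin (n + 2), i ≠ j → (q : ℂ) * w i - w j ≠ 0) :
    Acoef q σ w =
      (∏ j ∈ Finset.univ.filter (fun j : Fin (n + 2) => j < k),
        ((q : ℂ) * w (σ j) - w 0) / (w (σ j) - (q : ℂ) * w 0)) *
      Acoef q lam (w ∘ Fin.succ) := by
  have hk : σ⁻¹ 0 = k := by rw [Equiv.Perm.inv_eq_iff_eq, hσ]
  have hne (i : Fin (n + 1)) : (σ⁻¹ i.succ : ℕ) ≠ k := fun h =>
    Fin.succ_ne_zero i (σ⁻¹.injective ((Fin.ext h).trans hk.symm))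
  have hmono (i j : Fin (n + 1)) : lam⁻¹ i < lam⁻¹ j ↔ σ⁻¹ i.succ < σ⁻¹ j.succ := by
    have hi := hne i
    have hj := hne j
    rw [Fin.lt_def, Fin.lt_def, hlam, hlam]
    split_ifs <;> omega
  rw [Acoef_succ q σ lam hmono, hk]
  congr 1
  have hprod := Equiv.prod_comp σ (fun b => if σ⁻¹ b < k then
    ((q : ℂ) * w b - w 0) / (w b - (q : ℂ) * w 0) else 1)
  rw [Fin.prod_univ_succ (n := n + 1) (fun b => if σ⁻¹ b < k then _ else _), hk,
    if_neg (lt_irrefl k), one_mul] at hprod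
  simp only [Equiv.Perm.inv_def, Equiv.symm_apply_apply] at hprod
  rw [Finset.prod_filter]
  exact hprod.symm
end
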